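/- arXiv:math/9911069 — 7 statements merged into one kernel-verified Lean document; each statement's English description precedes it below -/
import Mathlib

section
/- Let A be a commutative local domain whose maximal ideal m is nonzero and not principal. Then every A-linear map u : m → A satisfies u(m) ⊆ m; consequently the injection Hom_A(m, m) → Hom_A(m, A) induced by the inclusion m ⊆ A is an isomorphism of A-modules. (Local form of Lemma 3.7(1): at a singular point Q of an integral curve, the sheaf Hom(M, M) equals Hom(M, O_C), where M is the ideal of Q.) -/
namespace Ideal

variable {R : Type*} [CommRing R] {I : Ideal R}

theorem mul_apply_comm (u : I →ₗ[R] R) (x y : I) : (x : R) * u y = y * u x := by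
  rw [← smul_eq_mul, ← map_smul, ← smul_eq_mul, ← map_smul]
  exact congrArg u (Subtype.ext (mul_comm _ _))

theorem isPrincipal_of_isUnit_apply (u : I →ₗ[R] R) {x : I} (hx : IsUnit (u x)) :
    I.IsPrincipal := by
  refine ⟨x, le_antisymm (fun y hy => ?_) ((span_singleton_le_iff_mem I).2 x.2)⟩
  rw [submodule_span_eq, mem_span_singleton, ← hx.dvd_mul_right, ← mul_apply_comm u x ⟨y, hy⟩]
  exact dvd_mul_right _ _

end Ideal

/-- Local form of Lemma 3.7(1): if `A` is a local domain whose maximal ideal `m` is nonzero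
and not principal (i.e. `A` is the local ring of a singular point of an integral curve), then
every `A`-linear map `u : m → A` lands in `m`; consequently composition with the inclusion
`m ⊆ A` is an isomorphism `Hom_A(m, m) ≃ Hom_A(m, A)`. -/
theorem stmt_0 {A : Type*} [CommRing A] [IsDomain A] [IsLocalRing A]
    (hne : IsLocalRing.maximalIdeal A ≠ ⊥)
    (hnp : ¬ (IsLocalRing.maximalIdeal A).IsPrincipal) :
    (∀ (u : (IsLocalRing.maximalIdeal A) →ₗ[A] A) (x : IsLocalRing.maximalIdeal A),
        u x ∈ IsLocalRing.maximalIdeal A) ∧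
      Function.Bijective
        (fun f : ((IsLocalRing.maximalIdeal A) →ₗ[A] (IsLocalRing.maximalIdeal A)) =>
          (IsLocalRing.maximalIdeal A).subtype ∘ₗ f) := by
  have key (u : (IsLocalRing.maximalIdeal A) →ₗ[A] A) (x : IsLocalRing.maximalIdeal A) :
      u x ∈ IsLocalRing.maximalIdeal A :=
    (IsLocalRing.mem_maximalIdeal _).2 fun hx => hnp (Ideal.isPrincipal_of_isUnit_apply u hx)
  refine ⟨key, fun f g hfg => ?_, fun u => ⟨u.codRestrict _ (key u), ?_⟩⟩
  · exact LinearMap.ext fun x => Subtype.ext (LinearMap.congr_fun hfg x)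
  · exact LinearMap.subtype_comp_codRestrict _ _ _
end

section
/- Let A be a commutative Noetherian local domain with nonzero maximal ideal m and fraction field K, and assume A satisfies biduality. Let B be a subring of K containing A, with B ≠ A, that is finitely generated as an A-module. Then (A : m) ⊆ B; in particular {x ∈ K : x·m ⊆ m} ⊆ B. (Local form of Lemma 3.7(3): if the curve is Gorenstein at Q, then every birational map nontrivial at Q factors through Spec(Hom(M, M)), where M is the ideal of Q.) -/
/-- The colon construction `(I : J) := {x ∈ K ∣ x·J ⊆ I}` for `A`-submodules of `K`. -/
def colonK {A K : Type*} [CommRing A] [CommRing K] [Algebra A K]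
    (I J : Submodule A K) : Submodule A K where
  carrier := {x : K | ∀ y ∈ J, x * y ∈ I}
  add_mem' := by
    intro a b ha hb y hy
    rw [add_mul]
    exact I.add_mem (ha y hy) (hb y hy)
  zero_mem' := by
    intro y hy
    rw [zero_mul]
    exact I.zero_mem
  smul_mem' := by
    intro c x hx y hy
    rw [smul_mul_assoc]
    exact I.smul_mem c (hx y hy)

/-- The maximal ideal of the local ring `A`, viewed as an `A`-submodule of `K`. -/
def maxIdealK (A K : Type*) [CommRing A] [IsLocalRing A] [CommRing K] [Algebra A K] :
    Submodule A K :=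
  Submodule.map (Algebra.linearMap A K) (IsLocalRing.maximalIdeal A)

theorem colonK_antitone_right {A K : Type*} [CommRing A] [CommRing K] [Algebra A K]
    (I : Submodule A K) {J J' : Submodule A K} (h : J ≤ J') : colonK I J' ≤ colonK I J :=
  fun _ hx y hy => hx y (h hy)

theorem maxIdealK_le_one (A K : Type*) [CommRing A] [IsLocalRing A] [CommRing K] [Algebra A K] :
    maxIdealK A K ≤ 1 := by
  rintro _ ⟨a, -, rfl⟩
  exact Submodule.mem_one.2 ⟨a, rfl⟩

/-- The conductor of a proper overring of a local ring lies in the maximal ideal. -/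
theorem colonK_one_subalgebra_le_maxIdealK {A K : Type*} [CommRing A] [IsLocalRing A]
    [CommRing K] [Algebra A K] {B : Subalgebra A K} (hB : B ≠ ⊥) :
    colonK (1 : Submodule A K) (Subalgebra.toSubmodule B) ≤ maxIdealK A K := by
  intro x hx
  obtain ⟨a, rfl⟩ := Submodule.mem_one.1 (by simpa using hx 1 B.one_mem)
  refine ⟨a, (IsLocalRing.mem_maximalIdeal a).2 fun ha => hB (eq_bot_iff.2 fun b hb => ?_), rfl⟩
  obtain ⟨u, rfl⟩ := ha
  obtain ⟨c, hc⟩ := Submodule.mem_one.1 (hx b hb)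
  refine Algebra.mem_bot.2 ⟨(↑u⁻¹ : A) * c, ?_⟩
  rw [map_mul, hc, ← mul_assoc, ← map_mul, Units.inv_mul, map_one, one_mul]

/-- Local form of Lemma 3.7(3): let `A` be a Noetherian local domain with nonzero maximal
ideal `m` and fraction field `K`, satisfying biduality (the Gorenstein condition), and let
`B ⊆ K` be a subring properly containing `A` that is finite as an `A`-module.  Then
`(A : m) ⊆ B`; in particular `{x ∈ K : x·m ⊆ m} ⊆ B`. -/
theorem stmt_2 {A K : Type*} [CommRing A] [IsDomain A] [IsLocalRing A] [IsNoetherianRing A]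
    [Field K] [Algebra A K] [IsFractionRing A K]
    (hm : IsLocalRing.maximalIdeal A ≠ ⊥)
    (hbid : ∀ I : Submodule A K, I ≠ ⊥ → I.FG →
      colonK (1 : Submodule A K) (colonK (1 : Submodule A K) I) = I)
    (B : Subalgebra A K) (hBne : B ≠ ⊥) (hBfg : (Subalgebra.toSubmodule B).FG) :
    colonK (1 : Submodule A K) (maxIdealK A K) ≤ Subalgebra.toSubmodule B ∧
      ∀ x : K, (∀ y ∈ maxIdealK A K, x * y ∈ maxIdealK A K) → x ∈ B := by
  have hB0 : Subalgebra.toSubmodule B ≠ ⊥ := fun h =>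
    one_ne_zero ((Submodule.mem_bot A).1 (h ▸ B.one_mem : (1 : K) ∈ (⊥ : Submodule A K)))
  have hle : colonK (1 : Submodule A K) (maxIdealK A K) ≤ Subalgebra.toSubmodule B :=
    (colonK_antitone_right 1 (colonK_one_subalgebra_le_maxIdealK hBne)).trans
      (hbid _ hB0 hBfg).le
  exact ⟨hle, fun x hx => hle fun y hy => maxIdealK_le_one A K (hx y hy)⟩
end

section
/- Let A be a commutative Noetherian local domain with nonzero maximal ideal m and fraction field K, and assume A satisfies biduality. Then for every finitely generated A-submodule D of K with A ⊊ D, one has (A : m) ⊆ D. (Module-theoretic strengthening of Lemma 3.7(3), used in the proof of Lemma 3.8: since D' := (A : D) is a proper ideal, it lies in m, and dualizing gives (A : m) ⊆ (A : D') = D.) -/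
/-- Module-theoretic strengthening of Lemma 3.7(3): if `A` is a Noetherian local domain with
nonzero maximal ideal `m` and fraction field `K`, satisfying biduality, then every finitely
generated `A`-submodule `D` of `K` strictly containing `A` contains `(A : m)`. -/
theorem stmt_3 {A K : Type*} [CommRing A] [IsDomain A] [IsLocalRing A] [IsNoetherianRing A]
    [Field K] [Algebra A K] [IsFractionRing A K]
    (hm : IsLocalRing.maximalIdeal A ≠ ⊥)
    (hbid : ∀ I : Submodule A K, I ≠ ⊥ → I.FG →
      colonK (1 : Submodule A K) (colonK (1 : Submodule A K) I) = I)
    (D : Submodule A K) (hDfg : D.FG) (hD : (1 : Submodule A K) < D) :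
    colonK (1 : Submodule A K) (maxIdealK A K) ≤ D := by
  have hD0 : D ≠ ⊥ := ne_bot_of_gt hD
  rw [← hbid D hD0 hDfg]
  intro x hx y hy
  have hy1 : y ∈ (1 : Submodule A K) := by
    simpa using hy 1 (hD.le (Submodule.mem_one.mpr ⟨1, map_one _⟩))
  obtain ⟨a, rfl⟩ := Submodule.mem_one.mp hy1
  refine hx _ ⟨a, ?_, rfl⟩
  by_contra ha
  have hu : IsUnit a := by simpa using ha
  obtain ⟨u, rfl⟩ := hu
  refine hD.not_ge fun d hd => ?_
  have h := (1 : Submodule A K).smul_mem (↑u⁻¹ : A) (hy d hd)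
  rwa [← Algebra.smul_def, smul_smul, Units.inv_mul, one_smul] at h
end

section
/- Let A be a commutative Noetherian local domain of Krull dimension 1 whose maximal ideal m is nonzero and not principal, with fraction field K. Assume A satisfies biduality and that the integral closure Ā of A in K is finitely generated as an A-module. Set B := {x ∈ K : x·m ⊆ m}. Then for every fractional ideal I of A: B·I ⊆ I (i.e., I is a module over the ring B) if and only if I is not principal. (Local form of Lemma 3.8: a torsion-free rank-1 sheaf I on a curve Gorenstein at a singular point Q is the pushforward of a sheaf on Spec(Hom(M,M)) if and only if I is not invertible at Q.) -/
/-- If `I` is not principal, then every product of an element of `I` with an element of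
`(A : I)` lies in the maximal ideal. -/
theorem mul_mem_maxIdealK_of_not_isPrincipal {A K : Type*} [CommRing A] [IsLocalRing A]
    [Field K] [Algebra A K] {I : Submodule A K} (hI : ¬ I.IsPrincipal) {x y : K}
    (hx : x ∈ colonK (1 : Submodule A K) I) (hy : y ∈ I) : x * y ∈ maxIdealK A K := by
  obtain ⟨a, ha⟩ := Submodule.mem_one.1 (hx y hy)
  refine ⟨a, ?_, ha⟩
  by_contra ham
  obtain ⟨u, rfl⟩ : IsUnit a := by simpa using ham
  refine hI ⟨y, le_antisymm (fun z hz ↦ ?_) ?_⟩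
  · obtain ⟨b, hb⟩ := Submodule.mem_one.1 (hx z hz)
    have hu : x * y ≠ 0 := ha ▸ (u.isUnit.map (algebraMap A K)).ne_zero
    have hx0 : x ≠ 0 := left_ne_zero_of_mul hu
    refine Submodule.mem_span_singleton.2 ⟨b * ↑u⁻¹, mul_left_cancel₀ hx0 ?_⟩
    have huinv : algebraMap A K ↑u⁻¹ * (x * y) = 1 := by
      rw [← ha, ← map_mul, Units.inv_mul, map_one]
    rw [Algebra.smul_def, map_mul, hb]
    linear_combination (x * z) * huinv
  · simpa using hy

/-- If the maximal ideal becomes principal as a submodule of `K`, it is principal. -/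
theorem isPrincipal_maximalIdeal_of_maxIdealK {A K : Type*} [CommRing A] [IsDomain A]
    [IsLocalRing A] [Field K] [Algebra A K] [IsFractionRing A K]
    (h : (maxIdealK A K).IsPrincipal) : (IsLocalRing.maximalIdeal A).IsPrincipal := by
  obtain ⟨g, hg⟩ := h
  obtain ⟨a, -, rfl⟩ : g ∈ maxIdealK A K := hg ▸ Submodule.mem_span_singleton_self g
  refine ⟨a, Submodule.map_injective_of_injective (f := Algebra.linearMap A K)
    (IsFractionRing.injective A K) ?_⟩
  rw [Submodule.map_span, Set.image_singleton]
  exact hg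

/-- Local form of Lemma 3.8: let `A` be a one-dimensional Noetherian local domain whose
maximal ideal `m` is nonzero and not principal, with fraction field `K`; assume `A` satisfies
biduality and that the integral closure `Ā` of `A` in `K` is a finite `A`-module.  Set
`B := {x ∈ K : x·m ⊆ m}`.  Then a fractional ideal `I` of `A` is a `B`-module
(`B·I ⊆ I`) if and only if `I` is not principal. -/
theorem stmt_4 {A K : Type*} [CommRing A] [IsDomain A] [IsLocalRing A] [IsNoetherianRing A]
    [Field K] [Algebra A K] [IsFractionRing A K]
    (hdim : ringKrullDim A = 1)
    (hm : IsLocalRing.maximalIdeal A ≠ ⊥)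
    (hmp : ¬ (IsLocalRing.maximalIdeal A).IsPrincipal)
    (hbid : ∀ I : Submodule A K, I ≠ ⊥ → I.FG →
      colonK (1 : Submodule A K) (colonK (1 : Submodule A K) I) = I)
    (hcl : (Subalgebra.toSubmodule (integralClosure A K)).FG)
    (I : Submodule A K) (hI0 : I ≠ ⊥) (hIfg : I.FG) :
    (∀ x ∈ colonK (maxIdealK A K) (maxIdealK A K), ∀ y ∈ I, x * y ∈ I) ↔
      ¬ I.IsPrincipal := by
  have hmK : ¬ (maxIdealK A K).IsPrincipal := fun h ↦
    hmp (isPrincipal_maximalIdeal_of_maxIdealK h)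
  constructor
  · rintro hB ⟨g, rfl⟩
    have hg : g ≠ 0 := by
      rintro rfl
      simp at hI0
    have hm0 : maxIdealK A K ≠ ⊥ := fun h ↦ hmK (h ▸ inferInstance)
    have hmfg : (maxIdealK A K).FG :=
      Submodule.FG.map _ (IsNoetherian.noetherian (IsLocalRing.maximalIdeal A))
    have h1 : (1 : K) ∈ maxIdealK A K := by
      rw [← hbid _ hm0 hmfg]
      intro x hx
      obtain ⟨a, ha⟩ := Submodule.mem_span_singleton.1 <|
        hB x (fun y hy ↦ mul_mem_maxIdealK_of_not_isPrincipal hmK hx hy) g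
          (Submodule.mem_span_singleton_self g)
      rw [one_mul]
      refine Submodule.mem_one.2 ⟨a, mul_right_cancel₀ hg ?_⟩
      rw [← ha, Algebra.smul_def]
    obtain ⟨a, ha, ha1⟩ := h1
    rw [Algebra.linearMap_apply, FaithfulSMul.algebraMap_eq_one_iff] at ha1
    exact (Ideal.ne_top_iff_one _).1 (IsLocalRing.maximalIdeal.isMaximal A).ne_top (ha1 ▸ ha)
  · intro hI x hx y hy
    rw [← hbid I hI0 hIfg]
    intro z hz
    obtain ⟨a, -, ha⟩ := hx _ (mul_mem_maxIdealK_of_not_isPrincipal hI hz hy)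
    exact Submodule.mem_one.2 ⟨a, by rw [mul_assoc, mul_comm y z]; exact ha⟩
end

section
/- Let A be a commutative Noetherian local domain of Krull dimension 1 with fraction field K whose integral closure Ā in K is finitely generated as an A-module. Let 𝔯 be the Jacobson radical of Ā, set 𝔠 := (A : Ā), and set G := (Ā : 𝔯)·𝔠. Then G is not contained in A. (Step in the proof of Lemma 3.8: if G ⊆ A then G ⊆ 𝔠, since 𝔠 is the largest Ā-submodule of A, whence 𝔠 ⊆ 𝔯·𝔠 and 𝔠 = 0 by Nakayama's lemma — absurd.) -/
/-- The integral closure of a one-dimensional Noetherian domain in its fraction field is a Dedekind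
domain as soon as it is a finite module. -/
theorem isDedekindDomain_integralClosure_of_fg {A K : Type*} [CommRing A] [IsDomain A]
    [IsNoetherianRing A] [Field K] [Algebra A K] [IsFractionRing A K] [Ring.DimensionLEOne A]
    (hcl : (Subalgebra.toSubmodule (integralClosure A K)).FG) :
    IsDedekindDomain (integralClosure A K) := by
  have : Module.Finite A (integralClosure A K) := Module.Finite.iff_fg.mpr hcl
  have : IsNoetherianRing (integralClosure A K) := IsNoetherianRing.of_finite A _
  have : IsFractionRing (integralClosure A K) K :=
    have := IsLocalization.isAlgebraic (R := A) K (nonZeroDivisors A)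
    integralClosure.isFractionRing_of_algebraic
      (fun x hx => (FaithfulSMul.algebraMap_eq_zero_iff A K).mp hx)
  have : IsIntegrallyClosed (integralClosure A K) :=
    integralClosure.isIntegrallyClosedOfFiniteExtension K
  have : Ring.DimensionLEOne (integralClosure A K) :=
    Ring.DimensionLEOne.integralClosure A K
  exact { }

/-- The extension of the maximal ideal of a local ring to an integral extension lies in the
Jacobson radical. -/
theorem algebraMap_mem_jacobson_bot_of_isIntegral {A B : Type*} [CommRing A] [IsLocalRing A]
    [CommRing B] [Algebra A B] [Algebra.IsIntegral A B] {a : A}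
    (ha : a ∈ IsLocalRing.maximalIdeal A) :
    algebraMap A B a ∈ (⊥ : Ideal B).jacobson := by
  rw [Ideal.jacobson, Ideal.mem_sInf]
  rintro M ⟨-, hM⟩
  have := Ideal.isMaximal_comap_of_isIntegral_of_isMaximal (R := A) M
  rw [← IsLocalRing.eq_maximalIdeal this] at ha
  exact ha

/-- Step in the proof of Lemma 3.8: let `A` be a one-dimensional Noetherian local domain with
fraction field `K` whose integral closure `Ā` in `K` is a finite `A`-module.  Let `𝔯` be the
Jacobson radical of `Ā`, let `𝔠 := (A : Ā)`, and let `G := (Ā : 𝔯)·𝔠`.  Then `G ⊄ A`. -/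
theorem stmt_6 {A K : Type*} [CommRing A] [IsDomain A] [IsLocalRing A] [IsNoetherianRing A]
    [Field K] [Algebra A K] [IsFractionRing A K]
    (hdim : ringKrullDim A = 1)
    (hcl : (Subalgebra.toSubmodule (integralClosure A K)).FG) :
    ¬ (colonK (Subalgebra.toSubmodule (integralClosure A K))
          (Submodule.map (integralClosure A K).val.toLinearMap
            (Submodule.restrictScalars A ((⊥ : Ideal (integralClosure A K)).jacobson))) *
        colonK (1 : Submodule A K) (Subalgebra.toSubmodule (integralClosure A K)) ≤
        (1 : Submodule A K)) := by
  intro hG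
  have : Ring.KrullDimLE 1 A := Order.krullDimLE_iff _ _ |>.mpr hdim.le
  have : Ring.DimensionLEOne A := ⟨fun hp hP => hP.isMaximal_of_ne_bot hp⟩
  have := isDedekindDomain_integralClosure_of_fg hcl
  have : IsFractionRing (integralClosure A K) K :=
    have := IsLocalization.isAlgebraic (R := A) K (nonZeroDivisors A)
    integralClosure.isFractionRing_of_algebraic
      (fun x hx => (FaithfulSMul.algebraMap_eq_zero_iff A K).mp hx)
  have hfield : ¬ IsField A := fun h => by
    have h0 := ringKrullDim_eq_zero_of_isField h
    rw [hdim] at h0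
    exact one_ne_zero h0
  obtain ⟨a, ha, ha0⟩ := Submodule.exists_mem_ne_zero_of_ne_bot
    ((IsLocalRing.isField_iff_maximalIdeal_eq (R := A)).not.mp hfield)
  have hr0 : (⊥ : Ideal (integralClosure A K)).jacobson ≠ ⊥ := fun h => by
    have h1 := algebraMap_mem_jacobson_bot_of_isIntegral (B := integralClosure A K) ha
    rw [h, Ideal.mem_bot] at h1
    exact ha0 ((FaithfulSMul.algebraMap_eq_zero_iff A _).mp h1)
  have hr1 : (⊥ : Ideal (integralClosure A K)).jacobson ≠ ⊤ := fun h =>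
    bot_ne_top (Ideal.jacobson_eq_top_iff.mp h)
  obtain ⟨x, hx, hx1⟩ := FractionalIdeal.exists_notMem_one_of_ne_bot (K := K) hr0 hr1
  have hxr : x ∈ colonK (Subalgebra.toSubmodule (integralClosure A K))
      (Submodule.map (integralClosure A K).val.toLinearMap
        (Submodule.restrictScalars A ((⊥ : Ideal (integralClosure A K)).jacobson))) := by
    rintro _ ⟨y, hy, rfl⟩
    rw [FractionalIdeal.mem_inv_iff (by simpa using hr0)] at hx
    obtain ⟨z, hz⟩ := (FractionalIdeal.mem_one_iff _).mp
      (hx _ (FractionalIdeal.mem_coeIdeal_of_mem _ hy))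
    exact hz ▸ z.2
  let c := colonK (1 : Submodule A K) (Subalgebra.toSubmodule (integralClosure A K))
  have hc1 : c ≤ 1 := fun y hy => by
    simpa using hy 1 (integralClosure A K).one_mem
  have hcfg : c.FG := by
    have h1 : (1 : Submodule A K).FG := by
      rw [Submodule.one_eq_span]
      exact Submodule.fg_span_singleton 1
    exact h1.of_le hc1
  have hc0 : c ≠ ⊥ := by
    obtain ⟨d, hd, hdB⟩ := FractionalIdeal.isFractional_of_fg (S := nonZeroDivisors A) hcl
    refine c.ne_bot_iff.mpr ⟨algebraMap A K d, fun y hy => ?_, ?_⟩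
    · obtain ⟨z, hz⟩ := hdB y hy
      rw [← Algebra.smul_def, ← hz]
      exact Submodule.algebraMap_mem z
    · exact (FaithfulSMul.algebraMap_eq_zero_iff A K).not.mpr (nonZeroDivisors.ne_zero hd)
  have hxc : ∀ y ∈ c, x • y ∈ c := fun y hy b hb => by
    rw [smul_eq_mul, mul_assoc]
    refine hG (Submodule.mul_mem_mul hxr fun b' hb' => ?_)
    rw [mul_assoc]
    exact hy _ ((integralClosure A K).mul_mem hb hb')
  have hxint : IsIntegral A x := isIntegral_of_smul_mem_submodule c hc0 hcfg x hxc
  exact hx1 ((FractionalIdeal.mem_one_iff _).mpr ⟨⟨x, hxint⟩, rfl⟩)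
end

section
/- Let A be a commutative Noetherian domain of Krull dimension 1 containing an infinite field, with fraction field K; let B be a subring of K containing A that is finitely generated as an A-module, and 𝔠 := (A : B) the conductor. Let N be a nonzero finitely generated A-submodule of K such that, for every maximal ideal Q of A containing 𝔠, the localization of N·B at the multiplicative set A∖Q is a cyclic module over the corresponding localization of B. Then there exists a finitely generated A-submodule M ⊆ N such that the localization of M at every maximal ideal Q of A containing 𝔠 is a cyclic module over the localization of A at Q, and M·B = N·B. (Algebraic form of Lemma 4.2(3): if N·O_{C†} is invertible along the conductor locus, then N contains a subsheaf M invertible along the conductor locus with M·O_{C†} = N·O_{C†}.) -/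
/-- The conductor `(A : B) = {x ∈ A ∣ x·B ⊆ A}` of a subring `A ⊆ B ⊆ K`, as an ideal of `A`. -/
def conductorIdeal {A K : Type*} [CommRing A] [CommRing K] [Algebra A K]
    (B : Subalgebra A K) : Ideal A :=
  (colonK (1 : Submodule A K) (Subalgebra.toSubmodule B)).comap (Algebra.linearMap A K)

/-- A finitely generated submodule that lies in `Y` locally at a prime `Q` is carried into `Y` by
a single element outside `Q`. -/
theorem exists_notMem_forall_smul_mem {A V : Type*} [CommRing A] [AddCommGroup V] [Module A V]
    {X Y : Submodule A V} (hX : X.FG) (Q : Ideal A) [Q.IsPrime]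
    (h : ∀ y ∈ X, ∃ s ∉ Q, s • y ∈ Y) : ∃ s ∉ Q, ∀ y ∈ X, s • y ∈ Y := by
  classical
  obtain ⟨S, rfl⟩ := hX
  have h' : ∀ y : S, ∃ s ∉ Q, s • (y : V) ∈ Y := fun y => h y (Submodule.subset_span y.2)
  choose f hf hfY using h'
  refine ⟨∏ y, f y, fun hmem => ?_, fun y hy => ?_⟩
  · obtain ⟨y, -, hy⟩ := (Ideal.IsPrime.prod_mem_iff (p := Q)).1 hmem
    exact hf y hy
  · have hle : Submodule.span A (S : Set V) ≤ Y.comap (LinearMap.lsmul A V (∏ y, f y)) := by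
      refine Submodule.span_le.2 fun z hz => ?_
      rw [SetLike.mem_coe, Submodule.mem_comap, LinearMap.lsmul_apply,
        ← Finset.prod_erase_mul _ _ (Finset.mem_univ (⟨z, hz⟩ : S)), mul_smul]
      exact Y.smul_mem _ (hfY ⟨z, hz⟩)
    exact hle hy

/-- In a finite algebra over a Noetherian domain of dimension at most one, only finitely many
primes lie over primes containing a given nonzero ideal of the base. -/
theorem finite_setOf_isPrime_le_comap {A B : Type*} [CommRing A] [IsDomain A] [IsNoetherianRing A]
    [Ring.KrullDimLE 1 A] [CommRing B] [Algebra A B] [Module.Finite A B] {I : Ideal A}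
    (hI : I ≠ ⊥) : {P : Ideal B | P.IsPrime ∧ I ≤ P.comap (algebraMap A B)}.Finite := by
  have : IsNoetherianRing B := IsNoetherianRing.of_finite A B
  refine ((I.map (algebraMap A B)).finite_minimalPrimes_of_isNoetherianRing).subset ?_
  rintro P ⟨hP, hIP⟩
  obtain ⟨p, hp, hpP⟩ := Ideal.exists_minimalPrimes_le (Ideal.map_le_iff_le_comap.2 hIP)
  have hpp : p.IsPrime := hp.1.1
  have hne : p.comap (algebraMap A B) ≠ ⊥ :=
    fun h => hI (le_bot_iff.1 (h ▸ Ideal.map_le_iff_le_comap.1 hp.1.2))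
  have hmax := Ideal.isMaximal_of_isIntegral_of_isMaximal_comap p
    (Ideal.IsPrime.isMaximal_of_ne_bot inferInstance hne)
  rwa [← hmax.eq_of_le hP.ne_top hpP]

/-- A submodule over an infinite field inside an algebra is not covered by finitely many
submodules not containing it. -/
theorem exists_mem_forall_notMem_of_not_le (F : Type*) {A V ι : Type*} [Field F] [Infinite F]
    [CommRing A] [Algebra F A] [AddCommGroup V] [Module A V] {s : Set ι} (hs : s.Finite)
    (N : Submodule A V) (W : ι → Submodule A V) (h : ∀ i ∈ s, ¬ N ≤ W i) :
    ∃ x ∈ N, ∀ i ∈ s, x ∉ W i := by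
  let _ : Module F N := Module.compHom N (algebraMap F A)
  have : IsScalarTower F A N := ⟨fun a b x => by
    rw [Algebra.smul_def, mul_smul]; rfl⟩
  have := hs.to_subtype
  by_contra! hcon
  obtain ⟨i, hi⟩ := Subspace.exists_eq_top_of_iUnion_eq_univ
    (p := fun i : s => ((W i).comap N.subtype).restrictScalars F) (by
      refine Set.eq_univ_of_forall fun x => ?_
      obtain ⟨i, hi, hx⟩ := hcon x x.2
      exact Set.mem_iUnion.2 ⟨⟨i, hi⟩, hx⟩)
  refine h i i.2 fun x hx => ?_
  have : (⟨x, hx⟩ : N) ∈ ((W i).comap N.subtype).restrictScalars F := hi ▸ Submodule.mem_top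
  exact this

section LocalGenerator

variable {A K : Type*} [CommRing A] [Field K] [Algebra A K] {B : Subalgebra A K}

/-- An ideal of the subalgebra `B`, viewed as an `A`-submodule of `K`. -/
def idealToSubmodule (P : Ideal B) : Submodule A K :=
  (P.restrictScalars A).map B.val.toLinearMap

theorem coe_mem_idealToSubmodule {P : Ideal B} {b : B} (hb : b ∈ P) :
    (b : K) ∈ idealToSubmodule P :=
  ⟨b, hb, rfl⟩

theorem exists_of_mem_idealToSubmodule {P : Ideal B} {z : K} (hz : z ∈ idealToSubmodule P) :
    ∃ b ∈ P, (b : K) = z := by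
  obtain ⟨b, hb, rfl⟩ := hz
  exact ⟨b, hb, rfl⟩

theorem idealToSubmodule_mul_toSubmodule_le (P : Ideal B) :
    idealToSubmodule P * Subalgebra.toSubmodule B ≤ idealToSubmodule P := by
  refine Submodule.mul_le.2 fun p hp b hb => ?_
  obtain ⟨p, hp', rfl⟩ := exists_of_mem_idealToSubmodule hp
  exact coe_mem_idealToSubmodule (P.mul_mem_right ⟨b, hb⟩ hp')

variable {X : Submodule A K} {g : K} {t : A} {P : Ideal B}

/-- Nakayama: a nonzero module generated locally at `P` by one element is not equal to its
product with `P`. -/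
theorem not_le_idealToSubmodule_mul (hX : X ≠ ⊥) (hg : g ∈ X)
    (htg : ∀ y ∈ X, t • y ∈ Subalgebra.toSubmodule B * Submodule.span A {g})
    [FaithfulSMul A K] [IsDomain A] (ht : algebraMap A B t ∉ P) :
    ¬ X ≤ idealToSubmodule P * X := by
  intro hle
  have ht0 : algebraMap A K t ≠ 0 := by
    intro h0
    refine ht ?_
    have : algebraMap A B t = 0 := Subtype.ext h0
    rw [this]
    exact P.zero_mem
  have hg0 : g ≠ 0 := by
    rintro rfl
    refine hX ((Submodule.eq_bot_iff _).2 fun y hy => ?_)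
    obtain ⟨z, -, hz⟩ := Submodule.mem_mul_span_singleton.1 (htg y hy)
    rw [mul_zero, Algebra.smul_def] at hz
    exact (mul_eq_zero.1 hz.symm).resolve_left ht0
  have key : idealToSubmodule P * X ≤
      (idealToSubmodule P * Submodule.span A {g}).comap (LinearMap.lsmul A K t) := by
    refine Submodule.mul_le.2 fun p hp y hy => ?_
    obtain ⟨b, hb, hby⟩ := Submodule.mem_mul_span_singleton.1 (htg y hy)
    rw [Submodule.mem_comap, LinearMap.lsmul_apply, ← mul_smul_comm, ← hby, ← mul_assoc]
    exact Submodule.mul_mem_mul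
      (idealToSubmodule_mul_toSubmodule_le P (Submodule.mul_mem_mul hp hb))
      (Submodule.mem_span_singleton_self g)
  obtain ⟨z, hz, hzg⟩ := Submodule.mem_mul_span_singleton.1 (key (hle hg))
  obtain ⟨p, hp, rfl⟩ := exists_of_mem_idealToSubmodule hz
  rw [LinearMap.lsmul_apply, Algebra.smul_def] at hzg
  have : p = algebraMap A B t := Subtype.ext (mul_right_cancel₀ hg0 hzg)
  exact ht (this ▸ hp)

/-- Nakayama: an element outside `P · X` generates `X` locally at the maximal ideal `P`, if `X`
is locally generated by one element. -/
theorem exists_notMem_forall_mul_mem_of_notMem [P.IsMaximal] (hg : g ∈ X)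
    (htg : ∀ y ∈ X, t • y ∈ Subalgebra.toSubmodule B * Submodule.span A {g})
    (ht : algebraMap A B t ∉ P) {x : K} (hx : x ∈ X) (hxP : x ∉ idealToSubmodule P * X) :
    ∃ b ∉ P, ∀ y ∈ X, (b : K) * y ∈ Subalgebra.toSubmodule B * Submodule.span A {x} := by
  obtain ⟨b, hb, hbx⟩ := Submodule.mem_mul_span_singleton.1 (htg x hx)
  rw [Algebra.smul_def] at hbx
  have hbP : (⟨b, hb⟩ : B) ∉ P := by
    intro hbP
    obtain ⟨u, p, hp, hup⟩ := Ideal.IsMaximal.exists_inv (I := P) inferInstance ht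
    refine hxP ?_
    have hup' : (u : K) * algebraMap A K t + p = 1 := congrArg Subtype.val hup
    have hxe : x = (u * ⟨b, hb⟩ : B) * g + p * x := by
      push_cast
      rw [mul_assoc, hbx, ← mul_assoc, ← add_mul, hup', one_mul]
    rw [hxe]
    exact add_mem
      (Submodule.mul_mem_mul (coe_mem_idealToSubmodule (P.mul_mem_left u hbP)) hg)
      (Submodule.mul_mem_mul (coe_mem_idealToSubmodule hp) hx)
  refine ⟨⟨b, hb⟩ * algebraMap A B t, fun h => ?_, fun y hy => ?_⟩
  · exact ((Ideal.IsMaximal.isPrime inferInstance : P.IsPrime).mem_or_mem h).elim hbP ht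
  · obtain ⟨c, hc, hcy⟩ := Submodule.mem_mul_span_singleton.1 (htg y hy)
    rw [Algebra.smul_def] at hcy
    refine Submodule.mem_mul_span_singleton.2 ⟨algebraMap A K t * c,
      B.mul_mem (B.algebraMap_mem t) hc, ?_⟩
    change _ = b * algebraMap A K t * y
    rw [mul_assoc b, ← hcy, mul_right_comm, ← hbx]
    ring

/-- If `X` is locally at `Q` generated by one element over `B`, then an element of `X` outside
`P · X` for all primes `P` of `B` over `Q` generates `X` locally at `Q`. -/
theorem exists_notMem_forall_smul_mem_of_forall_notMem [Algebra.IsIntegral A B]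
    {Q : Ideal A} [hQ : Q.IsMaximal] (hg : g ∈ X)
    (htg : ∀ y ∈ X, t • y ∈ Subalgebra.toSubmodule B * Submodule.span A {g})
    (ht : t ∉ Q) {x : K} (hx : x ∈ X)
    (hxP : ∀ P : Ideal B, P.IsPrime → P.comap (algebraMap A B) = Q →
      x ∉ idealToSubmodule P * X) :
    ∃ s ∉ Q, ∀ y ∈ X, s • y ∈ Subalgebra.toSubmodule B * Submodule.span A {x} := by
  let J : Ideal B :=
    { carrier := {b | ∀ y ∈ X, (b : K) * y ∈ Subalgebra.toSubmodule B * Submodule.span A {x}}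
      add_mem' := fun {a b} ha hb y hy => by
        rw [Subalgebra.coe_add, add_mul]
        exact add_mem (ha y hy) (hb y hy)
      zero_mem' := fun y _ => by
        rw [Subalgebra.coe_zero, zero_mul]
        exact zero_mem _
      smul_mem' := fun c b hb y hy => by
        obtain ⟨d, hd, hdx⟩ := Submodule.mem_mul_span_singleton.1 (hb y hy)
        refine Submodule.mem_mul_span_singleton.2 ⟨c * d, B.mul_mem c.2 hd, ?_⟩
        rw [smul_eq_mul, Subalgebra.coe_mul, mul_assoc, mul_assoc, hdx] }
  by_contra! hcon
  have hJQ : J.comap (algebraMap A B) ≤ Q := by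
    intro s hs
    by_contra hsQ
    obtain ⟨y, hy, hsy⟩ := hcon s hsQ
    rw [Algebra.smul_def] at hsy
    exact hsy (hs y hy)
  obtain ⟨P, hJP, hP, hPQ⟩ := Ideal.exists_ideal_over_prime_of_isIntegral Q J hJQ
  have hPmax : P.IsMaximal :=
    Ideal.isMaximal_of_isIntegral_of_isMaximal_comap P (by rwa [hPQ])
  obtain ⟨b, hb, hbX⟩ := exists_notMem_forall_mul_mem_of_notMem hg htg
    (fun h => ht (hPQ ▸ Ideal.mem_comap.2 h)) hx (hxP P hP hPQ)
  exact hb (hJP hbX)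

end LocalGenerator

theorem conductorIdeal_ne_bot {A K : Type*} [CommRing A] [IsDomain A] [Field K] [Algebra A K]
    [IsFractionRing A K] {B : Subalgebra A K} (hB : (Subalgebra.toSubmodule B).FG) :
    conductorIdeal B ≠ ⊥ := by
  obtain ⟨a, ha, h⟩ := FractionalIdeal.isFractional_of_fg (S := nonZeroDivisors A) hB
  refine (Submodule.ne_bot_iff _).2 ⟨a, fun y hy => ?_, nonZeroDivisors.ne_zero ha⟩
  obtain ⟨c, hc⟩ := h y hy
  rw [Algebra.linearMap_apply, ← Algebra.smul_def, ← hc]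
  exact Submodule.mem_one.2 ⟨c, rfl⟩

/-- Algebraic form of Lemma 4.2(3): let `A` be a one-dimensional Noetherian domain containing
an infinite field, with fraction field `K`; let `B ⊆ K` be a subring containing `A`, finite
as an `A`-module, with conductor `𝔠 := (A : B)`.  If `N` is a nonzero finitely generated
`A`-submodule of `K` such that `N·B` is locally cyclic over `B` at every maximal ideal of `A`
containing `𝔠`, then there is a finitely generated `A`-submodule `M ⊆ N` that is locally
cyclic over `A` at every maximal ideal containing `𝔠` and satisfies `M·B = N·B`. -/
theorem stmt_9 {A K F : Type*} [CommRing A] [IsDomain A] [IsNoetherianRing A]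
    [Field K] [Algebra A K] [IsFractionRing A K]
    [Field F] [Infinite F] [Algebra F A]
    (hdim : ringKrullDim A = 1)
    (B : Subalgebra A K) (hBfg : (Subalgebra.toSubmodule B).FG)
    (N : Submodule A K) (hN0 : N ≠ ⊥) (hNfg : N.FG)
    (hloc : ∀ Q : Ideal A, Q.IsMaximal → conductorIdeal B ≤ Q →
      ∃ x ∈ N * Subalgebra.toSubmodule B, ∀ y ∈ N * Subalgebra.toSubmodule B,
        ∃ b ∈ B, ∃ s : A, s ∉ Q ∧ algebraMap A K s * y = b * x) :
    ∃ M : Submodule A K, M.FG ∧ M ≤ N ∧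
      (∀ Q : Ideal A, Q.IsMaximal → conductorIdeal B ≤ Q →
        ∃ x ∈ M, ∀ y ∈ M, ∃ a s : A, s ∉ Q ∧
          algebraMap A K s * y = algebraMap A K a * x) ∧
      M * Subalgebra.toSubmodule B = N * Subalgebra.toSubmodule B := by
  have : Ring.KrullDimLE 1 A := Ring.krullDimLE_iff.2 hdim.le
  have : Module.Finite A B := Module.Finite.iff_fg.2 hBfg
  set X := N * Subalgebra.toSubmodule B with hX
  have hXfg : X.FG := hNfg.mul hBfg
  have hBB : Subalgebra.toSubmodule B * Subalgebra.toSubmodule B = Subalgebra.toSubmodule B :=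
    Subalgebra.isIdempotentElem_toSubmodule B
  have hXB : X * Subalgebra.toSubmodule B = X := by rw [hX, mul_assoc, hBB]
  have hNX : N ≤ X := fun n hn => by
    simpa using Submodule.mul_mem_mul hn (show (1 : K) ∈ Subalgebra.toSubmodule B from B.one_mem)
  have hX0 : X ≠ ⊥ := fun h => hN0 (le_bot_iff.1 (h ▸ hNX))
  have hgen : ∀ Q : Ideal A, Q.IsMaximal → conductorIdeal B ≤ Q → ∃ g ∈ X, ∃ t ∉ Q,
      ∀ y ∈ X, t • y ∈ Subalgebra.toSubmodule B * Submodule.span A {g} := by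
    intro Q hQ hcQ
    obtain ⟨g, hg, h⟩ := hloc Q hQ hcQ
    refine ⟨g, hg, exists_notMem_forall_smul_mem hXfg Q fun y hy => ?_⟩
    obtain ⟨b, hb, s, hs, hsy⟩ := h y hy
    refine ⟨s, hs, Submodule.mem_mul_span_singleton.2 ⟨b, hb, ?_⟩⟩
    rw [Algebra.smul_def, hsy]
  have hc0 := conductorIdeal_ne_bot hBfg
  obtain ⟨x, hxN, hx⟩ := exists_mem_forall_notMem_of_not_le F
    (finite_setOf_isPrime_le_comap (B := B) hc0) N (fun P => idealToSubmodule P * X) (by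
      rintro P ⟨hP, hcP⟩ hle
      have hmax : (P.comap (algebraMap A B)).IsMaximal :=
        Ideal.IsPrime.isMaximal_of_ne_bot inferInstance fun h => hc0 (le_bot_iff.1 (hcP.trans h.le))
      obtain ⟨g, hg, t, ht, htg⟩ := hgen _ hmax hcP
      refine not_le_idealToSubmodule_mul hX0 hg htg ht ?_
      calc X ≤ idealToSubmodule P * X * Subalgebra.toSubmodule B := mul_le_mul_left hle _
        _ = idealToSubmodule P * X := by rw [mul_assoc, hXB])
  have hxX : ∀ Q : Ideal A, Q.IsMaximal → conductorIdeal B ≤ Q →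
      ∃ s ∉ Q, ∀ y ∈ X, s • y ∈ Subalgebra.toSubmodule B * Submodule.span A {x} := by
    intro Q hQ hcQ
    obtain ⟨g, hg, t, ht, htg⟩ := hgen Q hQ hcQ
    exact exists_notMem_forall_smul_mem_of_forall_notMem hg htg ht (hNX hxN)
      fun P hP hPQ => hx P ⟨hP, hPQ.symm ▸ hcQ⟩
  have hMN : Submodule.span A {x} ⊔ conductorIdeal B • N ≤ N :=
    sup_le ((Submodule.span_singleton_le_iff_mem _ _).2 hxN) Submodule.smul_le_right
  have : IsNoetherian A N := isNoetherian_of_fg_of_noetherian N hNfg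
  refine ⟨Submodule.span A {x} ⊔ conductorIdeal B • N, ?_, hMN, ?_, ?_⟩
  · exact (Submodule.fg_span_singleton x).sup
      (Submodule.FG.smul (IsNoetherian.noetherian _) hNfg)
  · intro Q hQ hcQ
    obtain ⟨s, hs, hsx⟩ := hxX Q hQ hcQ
    refine ⟨x, Submodule.mem_sup_left (Submodule.mem_span_singleton_self x), fun y hy => ?_⟩
    have hle : Submodule.span A {x} ⊔ conductorIdeal B • N ≤
        (Submodule.span A {x}).comap (LinearMap.lsmul A K s) := by
      refine sup_le (fun z hz => Submodule.smul_mem _ s hz) (Submodule.smul_le.2 ?_)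
      intro c hc n hn
      obtain ⟨b, hb, hbx⟩ := Submodule.mem_mul_span_singleton.1 (hsx n (hNX hn))
      obtain ⟨a, ha⟩ := Submodule.mem_one.1 (hc b hb)
      refine Submodule.mem_span_singleton.2 ⟨a, ?_⟩
      rw [LinearMap.lsmul_apply, smul_comm, ← hbx, Algebra.smul_def, Algebra.smul_def, ha,
        Algebra.linearMap_apply, mul_assoc]
    obtain ⟨a, ha⟩ := Submodule.mem_span_singleton.1 (hle hy)
    refine ⟨a, s, hs, ?_⟩
    rw [← Algebra.smul_def, ← Algebra.smul_def, ha, LinearMap.lsmul_apply]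
  · refine le_antisymm (mul_le_mul_left hMN _) ?_
    set Y := (Submodule.span A {x} ⊔ conductorIdeal B • N) * Subalgebra.toSubmodule B with hY
    have htop : Y.colon (X : Set K) = ⊤ := by
      by_contra hne
      obtain ⟨Q, hQ, hle⟩ := Ideal.exists_le_maximal _ hne
      have hcQ : conductorIdeal B ≤ Q := by
        refine le_trans (fun c hc => ?_) hle
        refine Submodule.mem_colon.2 fun y hy => ?_
        have h1 : c • y ∈ conductorIdeal B • X := Submodule.smul_mem_smul hc hy
        rw [hX, ← smul_mul_assoc] at h1
        exact (mul_le_mul_left le_sup_right _ : _ ≤ Y) h1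
      obtain ⟨s, hs, hsx⟩ := hxX Q hQ hcQ
      refine hs (hle (Submodule.mem_colon.2 fun y hy => ?_))
      have h1 := hsx y hy
      rw [mul_comm] at h1
      exact (mul_le_mul_left le_sup_left _ : _ ≤ Y) h1
    intro y hy
    simpa using Submodule.mem_colon.1 (htop ▸ Submodule.mem_top : (1 : A) ∈ Y.colon (X : Set K)) y hy
end

section
/- Let A be a commutative Noetherian local domain with fraction field K satisfying biduality; let B be a subring of K containing A that is finitely generated as an A-module, and 𝔠 := (A : B) the conductor. Then B is the unique B-submodule J of K satisfying A ⊆ J and 𝔠·J ⊆ A. (Local form of Proposition 5.1(2)&(3) for F = O_C: when the curve is Gorenstein along the conductor locus, the comorphism O_C → φ_*O_{C†} is the one and only presentation with source O_C.) -/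
theorem mul_le_iff_le_colonK {A K : Type*} [CommRing A] [CommRing K] [Algebra A K]
    {I J L : Submodule A K} : J * L ≤ I ↔ L ≤ colonK I J := by
  rw [mul_comm, Submodule.mul_le]
  rfl

/-- Local form of Proposition 5.1(2)&(3) for `F = O_C`: let `A` be a Noetherian local domain
with fraction field `K`, satisfying biduality, and `B ⊆ K` a subring containing `A` that is
finite as an `A`-module, with conductor `𝔠 := (A : B)`.  Then `B` is the unique `B`-submodule
`J` of `K` with `A ⊆ J` and `𝔠·J ⊆ A`. -/
theorem stmt_11 {A K : Type*} [CommRing A] [IsDomain A] [IsLocalRing A] [IsNoetherianRing A]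
    [Field K] [Algebra A K] [IsFractionRing A K]
    (hbid : ∀ I : Submodule A K, I ≠ ⊥ → I.FG →
      colonK (1 : Submodule A K) (colonK (1 : Submodule A K) I) = I)
    (B : Subalgebra A K) (hBfg : (Subalgebra.toSubmodule B).FG) :
    ((1 : Submodule A K) ≤ Subalgebra.toSubmodule B ∧
        colonK (1 : Submodule A K) (Subalgebra.toSubmodule B) * Subalgebra.toSubmodule B ≤
          (1 : Submodule A K)) ∧
      ∀ J : Submodule A K, (∀ b ∈ B, ∀ x ∈ J, b * x ∈ J) →
        (1 : Submodule A K) ≤ J →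
        colonK (1 : Submodule A K) (Subalgebra.toSubmodule B) * J ≤ (1 : Submodule A K) →
        J = Subalgebra.toSubmodule B := by
  have hone : (1 : Submodule A K) ≤ Subalgebra.toSubmodule B :=
    Submodule.one_le.2 B.one_mem
  have hne : Subalgebra.toSubmodule B ≠ ⊥ := fun h =>
    one_ne_zero ((Submodule.eq_bot_iff _).1 h 1 B.one_mem)
  have hB := hbid _ hne hBfg
  refine ⟨⟨hone, mul_le_iff_le_colonK.2 hB.ge⟩, fun J hJ h1 hcJ => le_antisymm ?_ fun b hb => ?_⟩
  · exact (mul_le_iff_le_colonK.1 hcJ).trans hB.le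
  · simpa using hJ b hb 1 (Submodule.one_le.1 h1)
end
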